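/- For y ∈ I_n and indices 1 ≤ i < j ≤ n, define A_{ij}(y) = {w t_{ij} : w ∈ A(y), ℓ(w t_{ij}) = ℓ(w)+1}. If z, z' ∈ I_n satisfy A_{ij}(y) ∩ A(z) ≠ ∅ and A_{ij}(y) ∩ A(z') ≠ ∅, then z = z'. (Uniqueness of the target of the transition operator τ_{ij}.) -/

import Mathlib

open Equiv

/-- The simple transposition `s_a` of `Fin n` (swapping `a` and `a+1`, `0`-indexed);
the identity when `a` is out of range. -/
def sTr (n : ℕ) (a : ℕ) : Equiv.Perm (Fin n) :=
  if h : a + 1 < n then Equiv.swap ⟨a, Nat.lt_of_succ_lt h⟩ ⟨a + 1, h⟩ else 1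

/-- The product `s_{a_1} s_{a_2} ⋯ s_{a_l}` of the simple transpositions in a word. -/
def wordProd (n : ℕ) (l : List ℕ) : Equiv.Perm (Fin n) :=
  (l.map (sTr n)).prod

/-- A word whose letters are all valid indices of simple transpositions of `S_n`. -/
def IsWord (n : ℕ) (l : List ℕ) : Prop := ∀ a ∈ l, a + 1 < n

/-- The Coxeter length of a permutation: the minimal length of a word in the simple
transpositions expressing it. -/
noncomputable def len (n : ℕ) (w : Equiv.Perm (Fin n)) : ℕ :=
  sInf {k | ∃ l : List ℕ, IsWord n l ∧ wordProd n l = w ∧ l.length = k}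

/-- `l` is a reduced word for `w`: a minimal-length word with product `w`. -/
def IsReducedWord (n : ℕ) (l : List ℕ) (w : Equiv.Perm (Fin n)) : Prop :=
  IsWord n l ∧ wordProd n l = w ∧
    ∀ l' : List ℕ, IsWord n l' → wordProd n l' = w → l.length ≤ l'.length

/-- One step of the Demazure (0-Hecke) product: `u ∘ s_a = u s_a` if the length
increases, and `u` otherwise. -/
noncomputable def demStep (n : ℕ) (u : Equiv.Perm (Fin n)) (a : ℕ) : Equiv.Perm (Fin n) :=
  if len n (u * sTr n a) = len n u + 1 then u * sTr n a else u

/-- The Demazure product `s_{a_1} ∘ s_{a_2} ∘ ⋯ ∘ s_{a_l}` of a word. -/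
noncomputable def demWord (n : ℕ) (l : List ℕ) : Equiv.Perm (Fin n) :=
  l.foldl (demStep n) 1

/-- A choice of reduced word for each permutation. -/
noncomputable def redWord (n : ℕ) (w : Equiv.Perm (Fin n)) : List ℕ := by
  classical
  exact if h : ∃ l, IsReducedWord n l w then h.choose else []

/-- The Demazure product `v ∘ w` of two permutations: the Demazure product of the
concatenation of reduced words for `v` and for `w`. -/
noncomputable def dem (n : ℕ) (v w : Equiv.Perm (Fin n)) : Equiv.Perm (Fin n) :=
  demWord n (redWord n v ++ redWord n w)

/-- `s_{a_l} ∘ ⋯ ∘ s_{a_1} ∘ 1 ∘ s_{a_1} ∘ ⋯ ∘ s_{a_l}`, the involution-word product. -/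
noncomputable def invWordProd (n : ℕ) (l : List ℕ) : Equiv.Perm (Fin n) :=
  demWord n (l.reverse ++ l)

/-- `l` is an involution word for `y`: a minimal-length word with
`y = s_{a_l} ∘ ⋯ ∘ s_{a_1} ∘ 1 ∘ s_{a_1} ∘ ⋯ ∘ s_{a_l}`. -/
def IsInvWord (n : ℕ) (l : List ℕ) (y : Equiv.Perm (Fin n)) : Prop :=
  IsWord n l ∧ invWordProd n l = y ∧
    ∀ l' : List ℕ, IsWord n l' → invWordProd n l' = y → l.length ≤ l'.length

/-- `w` is an atom for `y`: a minimal-length permutation with `y = w⁻¹ ∘ w`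
(Demazure product). -/
def IsAtomOf (n : ℕ) (w y : Equiv.Perm (Fin n)) : Prop :=
  dem n w⁻¹ w = y ∧ ∀ v : Equiv.Perm (Fin n), dem n v⁻¹ v = y → len n w ≤ len n v

/-- The word `1, 3, 5, …, (n-1)` (in `1`-indexed terms), i.e. `0,2,4,…` `0`-indexed. -/
def fpfBase (n : ℕ) : List ℕ := (List.range (n / 2)).map (fun i => 2 * i)

/-- The minimal fixed-point-free involution `1^fpf_n = s_1 s_3 ⋯ s_{n-1}`. -/
def onefpf (n : ℕ) : Equiv.Perm (Fin n) := wordProd n (fpfBase n)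

/-- `s_{a_l} ⋯ s_{a_1} · 1^fpf_n · s_{a_1} ⋯ s_{a_l}` (ordinary products). -/
def conjWordProd (n : ℕ) (l : List ℕ) : Equiv.Perm (Fin n) :=
  wordProd n l.reverse * onefpf n * wordProd n l

/-- `l` is an fpf-involution word for `z`. -/
def IsFpfInvWord (n : ℕ) (l : List ℕ) (z : Equiv.Perm (Fin n)) : Prop :=
  IsWord n l ∧ conjWordProd n l = z ∧
    ∀ l' : List ℕ, IsWord n l' → conjWordProd n l' = z → l.length ≤ l'.length

/-- `w` is an fpf-atom for `z`: a minimal-length permutation with `z = w⁻¹ · 1^fpf_n · w`. -/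
def IsFpfAtomOf (n : ℕ) (w z : Equiv.Perm (Fin n)) : Prop :=
  w⁻¹ * onefpf n * w = z ∧
    ∀ v : Equiv.Perm (Fin n), v⁻¹ * onefpf n * v = z → len n w ≤ len n v

/-- Bruhat order on `S_n`: generated by `u < u t` for transpositions `t` that
increase length. -/
def BruhatLE (n : ℕ) (u w : Equiv.Perm (Fin n)) : Prop :=
  Relation.ReflTransGen
    (fun x y => len n x < len n y ∧ ∃ t : Equiv.Perm (Fin n), Equiv.Perm.IsSwap t ∧ y = x * t)
    u w

/-- The Rothe diagram `D(w) = {(i,j) : w(i) > j, w⁻¹(j) > i}` (`0`-indexed). -/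
def rothe (n : ℕ) (w : Equiv.Perm (Fin n)) : Finset (Fin n × Fin n) :=
  Finset.univ.filter (fun p => p.2 < w p.1 ∧ p.1 < w⁻¹ p.2)

/-- The number of inversions of a permutation. -/
def invNum (n : ℕ) (w : Equiv.Perm (Fin n)) : ℕ :=
  (Finset.univ.filter (fun p : Fin n × Fin n => p.1 < p.2 ∧ w p.2 < w p.1)).card

/-- The transpose of a finite diagram. -/
def trFinset (n : ℕ) (D : Finset (Fin n × Fin n)) : Finset (Fin n × Fin n) :=
  D.image (fun p => (p.2, p.1))

/-- The transpose of a diagram (as a set). -/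
def trSet {n : ℕ} (D : Set (Fin n × Fin n)) : Set (Fin n × Fin n) :=
  {p | (p.2, p.1) ∈ D}

/-- The northwest partial order: `(i,j) ≤ (i',j')` iff `i ≤ i'` and `j ≤ j'`. -/
def NWle {n : ℕ} (p q : Fin n × Fin n) : Prop := p.1 ≤ q.1 ∧ p.2 ≤ q.2

/-- A lower set for the northwest order (i.e., a Ferrers/partition diagram). -/
def IsLowerNW {n : ℕ} (S : Set (Fin n × Fin n)) : Prop :=
  ∀ p q : Fin n × Fin n, NWle p q → q ∈ S → p ∈ S

/-- The dominant component of a diagram: the union of all `≤_NW`-lower sets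
contained in it. -/
def domComp {n : ℕ} (D : Set (Fin n × Fin n)) : Set (Fin n × Fin n) :=
  ⋃₀ {S | IsLowerNW S ∧ S ⊆ D}

/-- The Lehmer code `c_i(w)`: the number of cells of the Rothe diagram in row `i`. -/
def code (n : ℕ) (w : Equiv.Perm (Fin n)) (i : Fin n) : ℕ :=
  (Finset.univ.filter (fun j : Fin n => (i, j) ∈ rothe n w)).card

/-- The involution code `ĉ_i(y)`: the number of `j > i` with `y(i) > y(j)` and
`i ≥ y(j)` (`0`-indexed translation of the `1`-indexed definition). -/
def invCode (n : ℕ) (y : Equiv.Perm (Fin n)) (i : Fin n) : ℕ :=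
  (Finset.univ.filter (fun j : Fin n => i < j ∧ y j < y i ∧ y j ≤ i)).card

/-- The fpf-involution code `ĉ^fpf_i(z)`: the number of `j > i` with `z(i) > z(j)`
and `i > z(j)`. -/
def fpfInvCode (n : ℕ) (z : Equiv.Perm (Fin n)) (i : Fin n) : ℕ :=
  (Finset.univ.filter (fun j : Fin n => i < j ∧ z j < z i ∧ z j < i)).card

/-- The word `b_1 a_1 b_2 a_2 ⋯ b_l a_l` with repeated letters removed, where
`a_1 < ⋯ < a_l` are the `a` with `a ≤ y(a)` and `b_i = y(a_i)`; this is the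
one-line notation of `α_min(y)⁻¹`. -/
def amWord (n : ℕ) (y : Equiv.Perm (Fin n)) : List (Fin n) :=
  (((List.finRange n).filter (fun a => a ≤ y a)).flatMap (fun a => [y a, a])).dedup

/-- The standard reading word of a diagram: read rows top to bottom, each row right
to left, recording the (`0`-indexed) antidiagonal index `i+j` of each cell. -/
def readWord (n : ℕ) (D : Finset (Fin n × Fin n)) : List ℕ :=
  (List.finRange n).flatMap (fun i =>
    ((List.finRange n).reverse.filter (fun j => (i, j) ∈ D)).map
      (fun j => (i : ℕ) + (j : ℕ)))

/-- `D` is a reduced pipe dream for `w`: a subset of the staircase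
`{(i,j) : i + j ≤ n}` (`1`-indexed) whose standard reading word is a reduced word
for `w`. -/
def IsPipeDream (n : ℕ) (D : Finset (Fin n × Fin n)) (w : Equiv.Perm (Fin n)) : Prop :=
  (∀ p ∈ D, (p.1 : ℕ) + (p.2 : ℕ) + 2 ≤ n) ∧ IsReducedWord n (readWord n D) w

/-! ### Inversions and length -/

theorem swap_cases {n : ℕ} (p q a : Fin n) :
    (a = p ∧ swap p q a = q) ∨ (a = q ∧ swap p q a = p) ∨
      (a ≠ p ∧ a ≠ q ∧ swap p q a = a) := by
  by_cases h1 : a = p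
  · subst h1; simp
  · by_cases h2 : a = q
    · subst h2; simp
    · simp [h1, h2, swap_apply_of_ne_of_ne h1 h2]

theorem invNum_lt {n : ℕ} (w : Perm (Fin n)) (p q : Fin n) (hpq : p < q) (hw : w p < w q) :
    invNum n w < invNum n (w * swap p q) := by
  classical
  unfold invNum
  have hcard : (Finset.univ.filter (fun x : Fin n × Fin n => x.1 < x.2 ∧ w x.2 < w x.1)).card ≤
    ((Finset.univ.filter (fun x : Fin n × Fin n => x.1 < x.2 ∧
      (w * swap p q) x.2 < (w * swap p q) x.1)).erase (p, q)).card := by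
    apply Finset.card_le_card_of_injOn
      (fun x => if swap p q x.1 < swap p q x.2 then (swap p q x.1, swap p q x.2) else x)
    · rintro ⟨a, b⟩ hx
      simp only [Finset.coe_filter, Finset.mem_univ, true_and, Set.mem_ofPred_eq] at hx
      simp only [Finset.coe_erase, Finset.coe_filter, Finset.mem_univ, true_and]
      rcases swap_cases p q a with ha | ha | ha <;> rcases swap_cases p q b with hb | hb | hb <;>
        (split_ifs with h <;> simp [Perm.mul_apply] at h ⊢ <;> grind)
    · rintro ⟨a, b⟩ hx ⟨a', b'⟩ hx' h
      simp only [Finset.coe_filter, Finset.mem_univ, true_and, Set.mem_ofPred_eq] at hx hx'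
      have hs : ∀ c, swap p q (swap p q c) = c := fun c => swap_apply_self p q c
      simp only at h
      split_ifs at h with h1 h2 h2 <;> simp only [Prod.mk.injEq] at h ⊢ <;> grind
  have hmem : (p, q) ∈ (Finset.univ.filter (fun x : Fin n × Fin n => x.1 < x.2 ∧
      (w * swap p q) x.2 < (w * swap p q) x.1)) := by
    simp only [Finset.mem_filter, Finset.mem_univ, true_and]
    exact ⟨hpq, by simpa using hw⟩
  have := Finset.card_erase_lt_of_mem hmem
  omega

theorem invNum_simple {n : ℕ} (w : Perm (Fin n)) (p q : Fin n) (hpq : q.val = p.val + 1)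
    (hw : w p < w q) : invNum n (w * swap p q) = invNum n w + 1 := by
  classical
  have h1 := invNum_lt w p q (by omega) hw
  suffices invNum n (w * swap p q) ≤ invNum n w + 1 by omega
  unfold invNum
  have hcard : ((Finset.univ.filter (fun x : Fin n × Fin n => x.1 < x.2 ∧
      (w * swap p q) x.2 < (w * swap p q) x.1)).erase (p, q)).card ≤
      (Finset.univ.filter (fun x : Fin n × Fin n => x.1 < x.2 ∧ w x.2 < w x.1)).card := by
    apply Finset.card_le_card_of_injOn (fun x => (swap p q x.1, swap p q x.2))
    · rintro ⟨a, b⟩ hx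
      rw [Finset.mem_coe, Finset.mem_erase, Finset.mem_filter] at hx
      simp only [Finset.mem_univ, true_and, ne_eq, Prod.mk.injEq, Perm.mul_apply] at hx
      simp only [Finset.coe_filter, Finset.mem_univ, true_and, Set.mem_ofPred_eq]
      refine ⟨?_, hx.2.2⟩
      rcases swap_cases p q a with ha | ha | ha <;> rcases swap_cases p q b with hb | hb | hb <;>
        grind
    · rintro ⟨a, b⟩ hx ⟨a', b'⟩ hx' h
      simp only [Prod.mk.injEq] at h
      simpa using h
  have := Finset.pred_card_le_card_erase (a := (p, q)) (s := (Finset.univ.filter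
    (fun x : Fin n × Fin n => x.1 < x.2 ∧ (w * swap p q) x.2 < (w * swap p q) x.1)))
  omega

theorem invNum_simple_down {n : ℕ} (w : Perm (Fin n)) (p q : Fin n) (hpq : q.val = p.val + 1)
    (hw : w q < w p) : invNum n w = invNum n (w * swap p q) + 1 := by
  have := invNum_simple (w * swap p q) p q hpq (by simpa using hw)
  simpa [mul_assoc] using this

theorem sTr_eq {n : ℕ} (p q : Fin n) (hpq : q.val = p.val + 1) : sTr n p.val = swap p q := by
  have hq := q.2
  have h : p.val + 1 < n := by omega
  unfold sTr
  rw [dif_pos h]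
  congr 1
  ext; simp [hpq]

theorem exists_pq {n c : ℕ} (hc : c + 1 < n) :
    ∃ p q : Fin n, q.val = p.val + 1 ∧ p.val = c :=
  ⟨⟨c, by omega⟩, ⟨c + 1, hc⟩, rfl, rfl⟩

theorem exists_descent {n : ℕ} (w : Perm (Fin n)) (i j : Fin n) (hij : i < j) (hw : w j < w i) :
    ∃ p q : Fin n, q.val = p.val + 1 ∧ w q < w p := by
  obtain ⟨k, hk⟩ : ∃ k, j.val = i.val + k + 1 := ⟨j.val - i.val - 1, by omega⟩
  induction k generalizing j with
  | zero => exact ⟨i, j, by omega, hw⟩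
  | succ k ih =>
    let m : Fin n := ⟨i.val + k + 1, by omega⟩
    by_cases h : w m < w i
    · exact ih m (by change i.val < i.val + k + 1; omega) h (by simp [m])
    · exact ⟨m, j, by simp only [m]; omega, by omega⟩

theorem eq_one_of_no_inv {n : ℕ} (w : Perm (Fin n)) (h : ∀ a b, a < b → w a < w b) : w = 1 := by
  have hm : StrictMono w := fun a b hab => h a b hab
  have := Subsingleton.elim (hm.orderIsoOfSurjective w w.surjective) (OrderIso.refl (Fin n))
  ext a
  have h2 := congrArg (fun f : Fin n ≃o Fin n => f a) this
  simp at h2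
  simp [h2]

theorem exists_descent_of_ne_one {n : ℕ} (w : Perm (Fin n)) (h : w ≠ 1) :
    ∃ p q : Fin n, q.val = p.val + 1 ∧ w q < w p := by
  by_contra hc
  apply h
  apply eq_one_of_no_inv
  intro a b hab
  by_contra hlt
  have hne : w a ≠ w b := fun h => by have := w.injective h; omega
  exact hc (exists_descent w a b hab (by omega))

theorem invNum_one (n : ℕ) : invNum n 1 = 0 := by
  simp only [invNum, Finset.card_eq_zero, Finset.filter_eq_empty_iff]
  rintro ⟨a, b⟩ - ⟨h1, h2⟩
  simp at h1 h2
  omega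

theorem wordProd_append (n : ℕ) (l l' : List ℕ) :
    wordProd n (l ++ l') = wordProd n l * wordProd n l' := by
  simp [wordProd]

theorem wordProd_single (n c : ℕ) : wordProd n [c] = sTr n c := by
  simp [wordProd]

theorem exists_word {n : ℕ} (w : Perm (Fin n)) :
    ∃ l, IsWord n l ∧ wordProd n l = w ∧ l.length = invNum n w := by
  obtain ⟨k, hk⟩ : ∃ k, invNum n w = k := ⟨_, rfl⟩
  induction k generalizing w with
  | zero =>
    by_cases h : w = 1
    · subst h
      exact ⟨[], by simp [IsWord], by simp [wordProd], by simp [hk]⟩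
    · obtain ⟨p, q, hpq, hd⟩ := exists_descent_of_ne_one w h
      have := invNum_simple_down w p q hpq hd
      omega
  | succ k ih =>
    by_cases h : w = 1
    · subst h
      rw [invNum_one] at hk; omega
    · obtain ⟨p, q, hpq, hd⟩ := exists_descent_of_ne_one w h
      have h1 := invNum_simple_down w p q hpq hd
      obtain ⟨l, hl1, hl2, hl3⟩ := ih (w * swap p q) (by omega)
      refine ⟨l ++ [p.val], ?_, ?_, ?_⟩
      · intro a ha
        rcases List.mem_append.1 ha with h | h
        · exact hl1 a h
        · simp at h; have := q.2; omega
      · rw [wordProd_append, wordProd_single, sTr_eq p q hpq, hl2]; simp [mul_assoc]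
      · simp; omega

theorem invNum_mul_sTr_le {n : ℕ} (w : Perm (Fin n)) (c : ℕ) (hc : c + 1 < n) :
    invNum n (w * sTr n c) ≤ invNum n w + 1 := by
  obtain ⟨p, q, hpq, rfl⟩ := exists_pq hc
  rw [sTr_eq p q hpq]
  rcases lt_trichotomy (w p) (w q) with h | h | h
  · rw [invNum_simple w p q hpq h]
  · have := w.injective h; omega
  · have := invNum_simple_down w p q hpq h; omega

theorem invNum_le_length {n : ℕ} (l : List ℕ) (hl : IsWord n l) :
    invNum n (wordProd n l) ≤ l.length := by
  induction l using List.reverseRecOn with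
  | nil => simp [wordProd, invNum_one]
  | append_singleton l c ih =>
    rw [wordProd_append, wordProd_single]
    have h1 := ih (fun a ha => hl a (by simp [ha]))
    have h2 := invNum_mul_sTr_le (wordProd n l) c (hl c (by simp))
    simp; omega

theorem len_eq {n : ℕ} (w : Perm (Fin n)) : len n w = invNum n w := by
  unfold len
  apply le_antisymm
  · exact Nat.sInf_le (exists_word w)
  · obtain ⟨l, hl⟩ := exists_word w
    have := Nat.sInf_mem (s := {k | ∃ l : List ℕ, IsWord n l ∧ wordProd n l = w ∧ l.length = k})
      ⟨_, l, hl⟩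
    obtain ⟨l', h1, h2, h3⟩ := this
    rw [← h3, ← h2]
    exact invNum_le_length l' h1

theorem reduced_iff {n : ℕ} (l : List ℕ) (w : Perm (Fin n)) :
    IsReducedWord n l w ↔ IsWord n l ∧ wordProd n l = w ∧ l.length = invNum n w := by
  constructor
  · rintro ⟨h1, h2, h3⟩
    refine ⟨h1, h2, le_antisymm ?_ ?_⟩
    · obtain ⟨l', hl'⟩ := exists_word w
      rw [← hl'.2.2]; exact h3 l' hl'.1 hl'.2.1
    · rw [← h2]; exact invNum_le_length l h1
  · rintro ⟨h1, h2, h3⟩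
    refine ⟨h1, h2, fun l' h1' h2' => ?_⟩
    rw [h3, ← h2']; exact invNum_le_length l' h1'

theorem redWord_spec {n : ℕ} (w : Perm (Fin n)) : IsReducedWord n (redWord n w) w := by
  have h : ∃ l, IsReducedWord n l w := by
    obtain ⟨l, hl⟩ := exists_word w
    exact ⟨l, (reduced_iff l w).2 hl⟩
  unfold redWord
  rw [dif_pos h]
  exact h.choose_spec

theorem wordProd_reverse (n : ℕ) (l : List ℕ) :
    wordProd n l.reverse = (wordProd n l)⁻¹ := by
  have hs : ∀ c, (sTr n c)⁻¹ = sTr n c := by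
    intro c; unfold sTr; split_ifs <;> simp
  induction l with
  | nil => simp [wordProd]
  | cons c l ih =>
    rw [List.reverse_cons, wordProd_append, ih, wordProd_single]
    simp [wordProd, hs]

theorem invNum_inv {n : ℕ} (w : Perm (Fin n)) : invNum n w⁻¹ = invNum n w := by
  have key : ∀ v : Perm (Fin n), invNum n v⁻¹ ≤ invNum n v := by
    intro v
    obtain ⟨l, h1, h2, h3⟩ := exists_word v
    rw [← h3, ← h2, ← wordProd_reverse, ← List.length_reverse]
    exact invNum_le_length _ (fun a ha => h1 a (by simpa using ha))
  apply le_antisymm (key w)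
  simpa using key w⁻¹

theorem reduced_reverse {n : ℕ} {l : List ℕ} {w : Perm (Fin n)} (h : IsReducedWord n l w) :
    IsReducedWord n l.reverse w⁻¹ := by
  rw [reduced_iff] at h ⊢
  exact ⟨fun a ha => h.1 a (by simpa using ha), by rw [wordProd_reverse, h.2.1],
    by rw [invNum_inv, ← h.2.2, List.length_reverse]⟩

/-! ### The Demazure product -/

theorem demStep_eq {n : ℕ} (u : Perm (Fin n)) (p q : Fin n) (hpq : q.val = p.val + 1) :
    demStep n u p.val = if u p < u q then u * swap p q else u := by
  unfold demStep
  rw [sTr_eq p q hpq, len_eq, len_eq]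
  by_cases h : u p < u q
  · rw [if_pos (invNum_simple u p q hpq h), if_pos h]
  · rw [if_neg h, if_neg]
    have hne : u p ≠ u q := fun h => by have := u.injective h; omega
    have := invNum_simple_down u p q hpq (by omega)
    omega

/-- Left Demazure step. -/
noncomputable def demL (n : ℕ) (a : ℕ) (u : Perm (Fin n)) : Perm (Fin n) :=
  (demStep n u⁻¹ a)⁻¹

theorem demL_eq {n : ℕ} (u : Perm (Fin n)) (p q : Fin n) (hpq : q.val = p.val + 1) :
    demL n p.val u = if u⁻¹ p < u⁻¹ q then swap p q * u else u := by
  unfold demL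
  rw [demStep_eq _ p q hpq]
  split_ifs <;> simp

theorem dem_comm {n : ℕ} (u : Perm (Fin n)) (a b : ℕ) (ha : a + 1 < n) (hb : b + 1 < n) :
    demStep n (demL n a u) b = demL n a (demStep n u b) := by
  obtain ⟨p, q, hpq, rfl⟩ := exists_pq ha
  obtain ⟨p', q', hpq', rfl⟩ := exists_pq hb
  rw [demL_eq _ p q hpq, demStep_eq _ p' q' hpq', demL_eq _ p q hpq, demStep_eq _ p' q' hpq']
  have hinv : ∀ x y, u⁻¹ x = y ↔ x = u y := fun x y => by
    rw [Perm.inv_eq_iff_eq]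
  by_cases hdeg : (u p' = p ∧ u q' = q) ∨ (u p' = q ∧ u q' = p)
  · have hcomm : swap p q * u = u * swap p' q' := by
      have h := Equiv.mul_swap_eq_swap_mul u p' q'
      rw [h]
      rcases hdeg with ⟨h1, h2⟩ | ⟨h1, h2⟩
      · rw [h1, h2]
      · rw [h1, h2, swap_comm]
    rcases hdeg with ⟨h1, h2⟩ | ⟨h1, h2⟩
    · have e1 : u⁻¹ p = p' := by rw [hinv, h1]
      have e2 : u⁻¹ q = q' := by rw [hinv, h2]
      have hp : p < q := by omega
      have hp' : p' < q' := by omega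
      rw [e1, e2, h1, h2, if_pos hp', if_pos hp]
      rw [hcomm]
      simp [Perm.mul_apply, h1, h2, e1, e2, not_lt_of_gt hp, not_lt_of_gt hp']
    · have e1 : u⁻¹ p = q' := by rw [hinv, h2]
      have e2 : u⁻¹ q = p' := by rw [hinv, h1]
      have hp : p < q := by omega
      have hp' : p' < q' := by omega
      rw [e1, e2, h1, h2, if_neg (not_lt_of_gt hp'), if_neg (not_lt_of_gt hp)]
      simp [h1, h2, e1, e2, not_lt_of_gt hp, not_lt_of_gt hp']
  · have k1 : (swap p q (u p') < swap p q (u q')) ↔ u p' < u q' := by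
      have hne : u p' ≠ u q' := fun h => by have := u.injective h; omega
      rcases swap_cases p q (u p') with h | h | h <;>
        rcases swap_cases p q (u q') with h' | h' | h' <;> grind
    have k2 : (swap p' q' (u⁻¹ p) < swap p' q' (u⁻¹ q)) ↔ u⁻¹ p < u⁻¹ q := by
      have hne : u⁻¹ p ≠ u⁻¹ q := fun h => by have := u⁻¹.injective h; omega
      have i1 := hinv p p'
      have i2 := hinv p q'
      have i3 := hinv q p'
      have i4 := hinv q q'
      rcases swap_cases p' q' (u⁻¹ p) with h | h | h <;>
        rcases swap_cases p' q' (u⁻¹ q) with h' | h' | h' <;> grind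
    have L1 : ((swap p q * u) p' < (swap p q * u) q') ↔ u p' < u q' := k1
    have L2 : ((u * swap p' q')⁻¹ p < (u * swap p' q')⁻¹ q) ↔ u⁻¹ p < u⁻¹ q := by
      rw [mul_inv_rev, swap_inv]; exact k2
    by_cases c1 : u p' < u q' <;> by_cases c2 : u⁻¹ p < u⁻¹ q <;>
      simp only [c1, c2, if_true, if_false, L1, L2, mul_assoc]

theorem foldl_comm {n : ℕ} (u : Perm (Fin n)) (a : ℕ) (l : List ℕ) (ha : a + 1 < n)
    (hl : IsWord n l) :
    l.foldl (demStep n) (demL n a u) = demL n a (l.foldl (demStep n) u) := by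
  induction l generalizing u with
  | nil => rfl
  | cons b l ih =>
    simp only [List.foldl_cons]
    rw [dem_comm u a b ha (hl b (by simp)), ih _ (fun x hx => hl x (by simp [hx]))]

theorem foldr_foldl_comm {n : ℕ} (u : Perm (Fin n)) (l' l : List ℕ) (hl' : IsWord n l')
    (hl : IsWord n l) :
    l.foldl (demStep n) (l'.foldr (demL n) u) = l'.foldr (demL n) (l.foldl (demStep n) u) := by
  induction l' with
  | nil => rfl
  | cons a l' ih =>
    simp only [List.foldr_cons]
    rw [foldl_comm _ _ _ (hl' a (by simp)) hl, ih (fun x hx => hl' x (by simp [hx]))]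

theorem reduced_init {n : ℕ} {l : List ℕ} {c : ℕ} {w : Perm (Fin n)}
    (h : IsReducedWord n (l ++ [c]) w) :
    c + 1 < n ∧ IsReducedWord n l (w * sTr n c) ∧ invNum n w = invNum n (w * sTr n c) + 1 := by
  rw [reduced_iff] at h
  obtain ⟨h1, h2, h3⟩ := h
  have hc : c + 1 < n := h1 c (by simp)
  have hl : IsWord n l := fun a ha => h1 a (by simp [ha])
  have hs : sTr n c * sTr n c = 1 := by unfold sTr; split_ifs <;> simp
  have hp : wordProd n l = w * sTr n c := by
    rw [← h2, wordProd_append, wordProd_single, mul_assoc, hs, mul_one]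
  have h4 := invNum_le_length l hl
  have h5 := invNum_mul_sTr_le (w * sTr n c) c hc
  rw [mul_assoc, hs, mul_one] at h5
  rw [hp] at h4
  simp at h3
  refine ⟨hc, (reduced_iff _ _).2 ⟨hl, hp, by omega⟩, by omega⟩

theorem foldl_reduced {n : ℕ} (l : List ℕ) (w : Perm (Fin n)) (h : IsReducedWord n l w) :
    l.foldl (demStep n) 1 = w := by
  induction l using List.reverseRecOn generalizing w with
  | nil => have := h.2.1; simpa [wordProd] using this
  | append_singleton l c ih =>
    obtain ⟨hc, hr, hi⟩ := reduced_init h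
    have hs : sTr n c * sTr n c = 1 := by unfold sTr; split_ifs <;> simp
    rw [List.foldl_append, ih _ hr]
    simp only [List.foldl_cons, List.foldl_nil, demStep]
    rw [mul_assoc, hs, mul_one, len_eq, len_eq, if_pos hi]

theorem foldr_reduced {n : ℕ} (l : List ℕ) (w : Perm (Fin n)) (h : IsReducedWord n l w) :
    l.foldr (demL n) 1 = w := by
  have key : ∀ l : List ℕ, l.foldr (demL n) 1 = (l.reverse.foldl (demStep n) 1)⁻¹ := by
    intro l
    induction l with
    | nil => simp
    | cons a l ih => simp [ih, demL, List.foldl_append]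
  rw [key, foldl_reduced _ _ (reduced_reverse h), inv_inv]

theorem foldl_eq_dem {n : ℕ} (v w : Perm (Fin n)) (l : List ℕ) (h : IsReducedWord n l w) :
    l.foldl (demStep n) v = dem n v w := by
  have main : ∀ l, IsReducedWord n l w →
      l.foldl (demStep n) v = (redWord n v).foldr (demL n) w := by
    intro l h
    have hv := redWord_spec v
    conv_lhs => rw [← foldr_reduced _ _ hv]
    rw [foldr_foldl_comm _ _ _ hv.1 h.1, foldl_reduced _ _ h]
  rw [main l h]
  unfold dem demWord
  rw [List.foldl_append, foldl_reduced _ _ (redWord_spec v), main _ (redWord_spec w)]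

theorem dem_descent {n : ℕ} (v : Perm (Fin n)) (p q : Fin n) (hpq : q.val = p.val + 1)
    (hv : v p < v q) :
    dem n (v * swap p q)⁻¹ (v * swap p q) = demStep n (demL n p.val (dem n v⁻¹ v)) p.val := by
  have hr := redWord_spec v
  have hp : p.val + 1 < n := by have := q.2; omega
  have hr' : IsReducedWord n (redWord n v ++ [p.val]) (v * swap p q) := by
    rw [reduced_iff] at hr ⊢
    refine ⟨?_, ?_, ?_⟩
    · intro a ha
      rcases List.mem_append.1 ha with h | h
      · exact hr.1 a h
      · simp at h; omega
    · rw [wordProd_append, wordProd_single, sTr_eq p q hpq, hr.2.1]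
    · rw [invNum_simple v p q hpq hv]; simp [hr.2.2]
  rw [← foldl_eq_dem _ _ _ hr', List.foldl_append]
  have e : (v * swap p q)⁻¹ = demL n p.val v⁻¹ := by
    rw [demL_eq _ p q hpq]; simp [hv]
  rw [e, foldl_comm _ _ _ hp hr.1, foldl_eq_dem _ _ _ hr]
  simp

theorem dem_one (n : ℕ) : dem n 1⁻¹ 1 = 1 := by
  have h : IsReducedWord n [] 1 := ⟨by simp [IsWord], by simp [wordProd], by simp⟩
  rw [← foldl_eq_dem _ _ _ h]; simp

theorem demStep_inv {n : ℕ} (x : Perm (Fin n)) (hx : x⁻¹ = x) (c : ℕ) (hc : c + 1 < n) :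
    (demStep n (demL n c x) c)⁻¹ = demStep n (demL n c x) c := by
  conv_rhs => rw [dem_comm _ _ _ hc hc]
  unfold demL
  rw [hx]

theorem dem_symm {n : ℕ} (w : Perm (Fin n)) : (dem n w⁻¹ w)⁻¹ = dem n w⁻¹ w := by
  obtain ⟨k, hk⟩ : ∃ k, invNum n w = k := ⟨_, rfl⟩
  induction k using Nat.strong_induction_on generalizing w with
  | _ k ih =>
    by_cases h : w = 1
    · subst h; rw [dem_one]; simp
    · obtain ⟨p, q, hpq, hd⟩ := exists_descent_of_ne_one w h
      have h1 := invNum_simple_down w p q hpq hd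
      have h2 := dem_descent (w * swap p q) p q hpq (by simpa using hd)
      have h3 : w * swap p q * swap p q = w := by simp [mul_assoc]
      rw [h3] at h2
      rw [h2]
      exact demStep_inv _ (ih _ (by omega) _ rfl) _ (by have := q.2; omega)

/-- The step from the atom `w * s` to the atom `w`, at a right descent. -/
theorem atom_down {n : ℕ} (w y : Perm (Fin n)) (h : IsAtomOf n w y) (p q : Fin n)
    (hpq : q.val = p.val + 1) (hd : w q < w p) :
    ∃ x, IsAtomOf n (w * swap p q) x ∧ x⁻¹ = x ∧ x p < x q ∧
      ((x p = p ∧ x q = q ∧ y = x * swap p q) ∨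
        (¬ (x p = p ∧ x q = q) ∧ y = swap p q * x * swap p q)) := by
  obtain ⟨hy, hmin⟩ := h
  set v := w * swap p q with hv
  have hw : v * swap p q = w := by simp [hv, mul_assoc]
  have hvpq : v p < v q := by simpa [hv] using hd
  have hlen := invNum_simple v p q hpq hvpq
  rw [hw] at hlen
  set x := dem n v⁻¹ v with hx
  have hxs : x⁻¹ = x := dem_symm v
  have hp : p.val + 1 < n := by have := q.2; omega
  have hplt : p < q := by omega
  have hyx : y = demStep n (demL n p.val x) p.val := by
    rw [← hy, ← hw, dem_descent v p q hpq hvpq]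
  have hne : y ≠ x := by
    intro h
    have := hmin v (by rw [← hx, h])
    rw [len_eq, len_eq] at this
    omega
  have hup : x p < x q := by
    by_contra hc
    apply hne
    rw [hyx, demL_eq _ p q hpq, hxs, if_neg hc, demStep_eq _ p q hpq, if_neg hc]
  refine ⟨x, ⟨rfl, ?_⟩, hxs, hup, ?_⟩
  · intro v' hv'
    by_contra hlt
    rw [len_eq, len_eq] at hlt
    rcases lt_trichotomy (v' p) (v' q) with h | h | h
    · have h1 := dem_descent v' p q hpq h
      rw [hv', ← hyx] at h1
      have h2 := hmin _ h1
      rw [len_eq, len_eq, invNum_simple v' p q hpq h] at h2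
      omega
    · have := v'.injective h; omega
    · have h1 := dem_descent (v' * swap p q) p q hpq (by simpa using h)
      have h3 : v' * swap p q * swap p q = v' := by simp [mul_assoc]
      rw [h3, hv', demStep_eq _ p q hpq] at h1
      have : ¬ x p < x q := by
        rw [h1]
        split_ifs with h5
        · simpa using h5.le
        · exact h5
      exact this hup
  · rw [demL_eq _ p q hpq, hxs, if_pos hup, demStep_eq _ p q hpq] at hyx
    have hxx : ∀ a, x (x a) = a := by
      intro a
      conv_lhs => rw [← hxs]
      rw [hxs]
      nth_rewrite 1 [← hxs]
      simp
    by_cases hf : x p = p ∧ x q = q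
    · left
      refine ⟨hf.1, hf.2, ?_⟩
      rw [hyx, if_neg]
      · have := Equiv.mul_swap_eq_swap_mul x p q
        rw [this, hf.1, hf.2]
      · simp [Perm.mul_apply, hf.1, hf.2, hplt.le]
    · right
      refine ⟨hf, ?_⟩
      rw [hyx, if_pos]
      simp only [Perm.mul_apply]
      rcases swap_cases p q (x p) with h | h | h <;>
        rcases swap_cases p q (x q) with h' | h' | h' <;> grind


/-! ### The local conditions satisfied by atoms -/

/-- Local conditions relating an atom `w` and an involution `y`. -/
structure Cond {n : ℕ} (w y : Fin n → Fin n) : Prop where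
  inv : ∀ a, y (y a) = a
  inj : ∀ a b, w a = w b → a = b
  c1 : ∀ a, a < y a → w (y a) < w a
  c1' : ∀ a e, a < e → e < y a → w (y a) < w e → w e < w a → False
  c2 : ∀ a b, a ≤ y a → b ≤ y b → a < b → y a < y b → w a < w (y b)

theorem cond_up_conj {n : ℕ} (v x w y : Fin n → Fin n) (h : Cond v x) (p q : Fin n)
    (hpq : q.val = p.val + 1) (hx : x p < x q) (hv : v p < v q)
    (hf : ¬ (x p = p ∧ x q = q)) (hw : ∀ a, w a = v (swap p q a))
    (hy : ∀ a, y a = swap p q (x (swap p q a))) : Cond w y := by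
  have hs : ∀ a, swap p q (swap p q a) = a := fun a => swap_apply_self p q a
  have hp : p < q := by omega
  have hpq' : ∀ a, a < q → a ≤ p := fun a h => by omega
  have hpq'' : ∀ a, p < a → q ≤ a := fun a h => by omega
  -- `s` preserves order except on `(p, q)`
  have mono : ∀ a b, a < b → ¬ (a = p ∧ b = q) → swap p q a < swap p q b := by
    intro a b hab hne
    rcases swap_cases p q a with ha | ha | ha <;> rcases swap_cases p q b with hb | hb | hb <;> grind
  have sp : swap p q p = q := swap_apply_left p q
  have sq : swap p q q = p := swap_apply_right p q
  refine ⟨?_, ?_, ?_, ?_, ?_⟩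
  · intro a
    simp only [hy, hs, h.inv]
  · intro a b hab
    simp only [hw] at hab
    exact (swap p q).injective (h.inj _ _ hab)
  · intro a ha
    simp only [hw, hy, hs]
    apply h.c1
    have := mono _ _ ha
    rw [hy, hs] at this
    apply this
    rintro ⟨rfl, h2⟩
    have := h.inv q
    grind
  · intro a e h1 h2 h3 h4
    simp only [hw] at h3 h4
    have hya : swap p q (y a) = x (swap p q a) := by rw [hy, hs]
    rw [hya] at h3
    have hyp : ∀ b, swap p q b = p → b = q := by grind
    have i1 := h.inv p
    have i2 := h.inv q
    by_cases e1 : a = p ∧ e = q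
    · obtain ⟨rfl, rfl⟩ := e1
      rw [sp] at h3 h4
      rw [sq] at h3 h4
      have g : e < x e := by
        have := mono _ _ h2
        grind
      rcases le_or_gt a (x a) with c | c
      · have := h.c2 a e c g.le hp hx
        grind
      · have := h.c2 (x a) e (by grind) g.le (by grind) (by grind)
        have := h.c1 (x a) (by grind)
        grind
    · by_cases e2 : e = p ∧ y a = q
      · obtain ⟨rfl, e2⟩ := e2
        rw [e2] at hya
        rw [sq] at hya
        have hsa : swap e q a = a := swap_apply_of_ne_of_ne (by grind) (by grind)
        rw [hsa] at hya h3 h4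
        have hxe : x e = a := by rw [hya, h.inv]
        rw [sp] at h3 h4
        rcases le_or_gt q (x q) with c | c
        · have := h.c2 a q (by grind) c (by grind) (by grind)
          rcases eq_or_lt_of_le c with c | c
          · grind
          · have := h.c1 q c
            grind
        · have := h.c2 a (x q) (by grind) (by grind) (by grind) (by grind)
          grind
      · have m1 := mono _ _ h1 e1
        have m2 := mono _ _ h2 e2
        rw [hya] at m2
        exact h.c1' _ _ m1 m2 h3 h4
  · intro a b ha hb hab hyab
    have hya : swap p q (y a) = x (swap p q a) := by rw [hy, hs]
    have hyb : swap p q (y b) = x (swap p q b) := by rw [hy, hs]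
    have hinj : ∀ a b, x a = x b → a = b := fun a b hh => by
      have := congrArg x hh; rwa [h.inv, h.inv] at this
    have key : ∀ a, a ≤ y a → swap p q a ≤ swap p q (y a) := by
      intro a ha
      rcases eq_or_lt_of_le ha with c | c
      · rw [← c]
      · apply (mono _ _ c _).le
        rintro ⟨rfl, h2⟩
        have := h.inv q
        grind
    have k1 := key a ha
    have k2 := key b hb
    rw [hw, hw, hyb]
    rw [hya] at k1
    rw [hyb] at k2
    apply h.c2 _ _ k1 k2
    · apply mono _ _ hab
      rintro ⟨rfl, rfl⟩
      have := mono _ _ hyab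
      grind
    · rw [← hya, ← hyb]
      apply mono _ _ hyab
      rintro ⟨e1, e2⟩
      have t1 : x q = swap p q a := by
        have := h.inv (swap p q a)
        rwa [← hya, e1, sp] at this
      have t2 : x p = swap p q b := by
        have := h.inv (swap p q b)
        rwa [← hyb, e2, sq] at this
      by_cases hh : a = p ∧ b = q
      · rw [hh.1, sp] at t1
        rw [hh.2, sq] at t2
        exact hf ⟨t2, t1⟩
      · have := mono _ _ hab hh
        rw [← t1, ← t2] at this
        exact lt_asymm this hx

theorem cond_up_fix {n : ℕ} (v x w y : Fin n → Fin n) (h : Cond v x) (p q : Fin n)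
    (hpq : q.val = p.val + 1) (hv : v p < v q)
    (hf : x p = p ∧ x q = q) (hw : ∀ a, w a = v (swap p q a))
    (hy : ∀ a, y a = x (swap p q a)) : Cond w y := by
  have hp : p < q := by omega
  have hpq' : ∀ a, a < q → a ≤ p := fun a h => by omega
  have hpq'' : ∀ a, p < a → q ≤ a := fun a h => by omega
  have sp : swap p q p = q := swap_apply_left p q
  have sq : swap p q q = p := swap_apply_right p q
  have so : ∀ a, a ≠ p → a ≠ q → swap p q a = a := fun a => swap_apply_of_ne_of_ne
  have hinj : ∀ a b, x a = x b → a = b := fun a b hh => by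
    have := congrArg x hh; rwa [h.inv, h.inv] at this
  have yp : y p = q := by rw [hy, sp, hf.2]
  have yq : y q = p := by rw [hy, sq, hf.1]
  have yo : ∀ a, a ≠ p → a ≠ q → y a = x a := fun a h1 h2 => by rw [hy, so a h1 h2]
  have wp : w p = v q := by rw [hw, sp]
  have wq : w q = v p := by rw [hw, sq]
  have wo : ∀ a, a ≠ p → a ≠ q → w a = v a := fun a h1 h2 => by rw [hw, so a h1 h2]
  have xo : ∀ a, a ≠ p → a ≠ q → x a ≠ p ∧ x a ≠ q := fun a h1 h2 =>
    ⟨fun hh => h1 (hinj _ _ (by rw [hh, hf.1])), fun hh => h2 (hinj _ _ (by rw [hh, hf.2]))⟩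
  obtain ⟨hfp, hfq⟩ := hf
  refine ⟨?_, ?_, ?_, ?_, ?_⟩
  · intro a
    by_cases a1 : a = p
    · grind
    · by_cases a2 : a = q
      · grind
      · rw [yo a a1 a2, yo _ (xo a a1 a2).1 (xo a a1 a2).2, h.inv]
  · intro a b hab
    simp only [hw] at hab
    exact (swap p q).injective (h.inj _ _ hab)
  · intro a ha
    have := h.c1 a
    have := xo a
    by_cases a1 : a = p
    · grind
    · by_cases a2 : a = q
      · grind
      · grind
  · intro a e h1 h2 h3 h4
    by_cases a1 : a = p
    · grind
    by_cases a2 : a = q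
    · grind
    have ax := xo a a1 a2
    rw [yo a a1 a2] at h2 h3
    rw [wo _ ax.1 ax.2] at h3
    rw [wo a a1 a2] at h4
    by_cases e1 : e = p
    · subst e1
      rw [wp] at h3 h4
      exact h.c1' a q (by grind) (by grind) h3 h4
    by_cases e2 : e = q
    · subst e2
      rw [wq] at h3 h4
      exact h.c1' a p (by grind) (by grind) h3 h4
    rw [wo e e1 e2] at h3 h4
    exact h.c1' a e h1 h2 h3 h4
  · intro a b ha hb hab hyab
    have hbq : b ≠ q := by grind
    have haq : a ≠ q := by grind
    by_cases a1 : a = p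
    · subst a1
      have b1 : b ≠ a := by grind
      have bx := xo b b1 hbq
      rw [yo b b1 hbq] at hb hyab ⊢
      rw [wo _ bx.1 bx.2, wp]
      exact hfq ▸ h.c2 q b (by grind) hb (by grind) (by grind)
    have ax := xo a a1 haq
    rw [yo a a1 haq] at ha hyab
    rw [wo a a1 haq]
    by_cases b1 : b = p
    · subst b1
      rw [yp, wq]
      have := h.c2 a b ha (by grind) hab (by grind)
      grind
    have bx := xo b b1 hbq
    rw [yo b b1 hbq] at hb hyab ⊢
    rw [wo _ bx.1 bx.2]
    exact h.c2 a b ha hb hab hyab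

theorem cond_of_atom {n : ℕ} (w y : Perm (Fin n)) (h : IsAtomOf n w y) : Cond w y := by
  obtain ⟨k, hk⟩ : ∃ k, invNum n w = k := ⟨_, rfl⟩
  induction k using Nat.strong_induction_on generalizing w y with
  | _ k ih =>
    by_cases h1 : w = 1
    · subst h1
      have := h.1
      rw [dem_one] at this
      subst this
      refine ⟨by simp, by simp, ?_, ?_, ?_⟩ <;> simp <;> grind
    · obtain ⟨p, q, hpq, hd⟩ := exists_descent_of_ne_one w h1
      have h2 := invNum_simple_down w p q hpq hd
      obtain ⟨x, hx1, hx2, hx3, hx4⟩ := atom_down w y h p q hpq hd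
      have hc := ih _ (by omega) _ _ hx1 rfl
      have hv : (w * swap p q) p < (w * swap p q) q := by simpa using hd
      have hw : ∀ a, w a = (w * swap p q) (swap p q a) := by simp
      rcases hx4 with ⟨f1, f2, rfl⟩ | ⟨f, rfl⟩
      · exact cond_up_fix _ _ _ _ hc p q hpq hv ⟨f1, f2⟩ hw (by simp)
      · exact cond_up_conj _ _ _ _ hc p q hpq hx3 hv f hw (by simp)


theorem Cond.two {n : ℕ} {w y : Fin n → Fin n} (h : Cond w y) (a b : Fin n) :
    (a < y a → w (y a) < w a) ∧ (b < y b → w (y b) < w b) ∧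
    (a < b → b < y a → w (y a) < w b → w b < w a → False) ∧
    (b < a → a < y b → w (y b) < w a → w a < w b → False) ∧
    (a ≤ y a → b ≤ y b → a < b → y a < y b → w a < w (y b)) ∧
    (b ≤ y b → a ≤ y a → b < a → y b < y a → w b < w (y a)) :=
  ⟨h.c1 a, h.c1 b, h.c1' a b, h.c1' b a, h.c2 a b, h.c2 b a⟩

theorem stable_off {n : ℕ} (x x' : Fin n → Fin n) (hx : ∀ a, x (x a) = a)
    (hx' : ∀ a, x' (x' a) = a) (i j : Fin n)
    (hoff : ∀ e, e ≠ i → e ≠ j → e ≠ x i → e ≠ x j → x' e = x e) (e : Fin n)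
    (he : e = i ∨ e = j ∨ e = x i ∨ e = x j) :
    x' e = i ∨ x' e = j ∨ x' e = x i ∨ x' e = x j := by
  by_contra hc
  push Not at hc
  have h1 := hoff (x' e) hc.1 hc.2.1 hc.2.2.1 hc.2.2.2
  rw [hx'] at h1
  have h2 : x e = x' e := by rw [h1, hx, ← h1]
  have := hx i
  have := hx j
  grind

set_option maxHeartbeats 4000000 in
theorem mixed1 {n : ℕ} (v x v' x' : Fin n → Fin n) (h : Cond v x) (h' : Cond v' x')
    (i j : Fin n) (hij : i < j) (hv : v i < v j)
    (hcov : ∀ e, i < e → e < j → v i < v e → v e < v j → False)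
    (hi : v' i = v j) (hj : v' j = v i) (hv' : ∀ e, e ≠ i → e ≠ j → v' e = v e)
    (hoff : ∀ e, e ≠ i → e ≠ j → e ≠ x i → e ≠ x j → x' e = x e)
    (p q : Fin n) (hpq : q.val = p.val + 1) (hp' : x' p = p) (hp : x p < p)
    (hq : x q = q) (hq' : x' q = q)
    (hqA : q ≠ i ∧ q ≠ j ∧ q ≠ x i ∧ q ≠ x j)
    (hpA : p = i ∨ p = j ∨ p = x i ∨ p = x j) : False := by
  have hplt : p < q := by omega
  have hpq' : ∀ a, a < q → a ≠ p → a < p := fun a h => by omega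
  have hpq'' : ∀ a, p < a → a ≠ q → q < a := fun a h => by omega
  have st := stable_off x x' h.inv h'.inv i j hoff
  have s1 := st i (by simp)
  have s2 := st j (by simp)
  have s3 := st (x i) (by simp)
  have s4 := st (x j) (by simp)
  have i1 := h.inv i
  have i2 := h.inv j
  have i1' := h'.inv i
  have i2' := h'.inv j
  have i3' := h'.inv (x i)
  have i4' := h'.inv (x j)
  have hvq := hv' q hqA.1 hqA.2.1
  have hvp := h.c1 (x p) (by rw [h.inv]; exact hp)
  rw [h.inv] at hvp
  have hvq2 := h.c2 (x p) q (by rw [h.inv]; exact hp.le) hq.ge (by grind) (by rw [h.inv, hq]; exact hplt)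
  rw [hq] at hvq2
  have hpq2 := h'.c2 p q hp'.ge hq'.ge hplt (by rw [hp', hq']; exact hplt)
  rw [hq'] at hpq2
  clear hoff st
  generalize hk : x i = k at *
  generalize hl : x j = l at *
  rcases hpA with rfl | rfl | rfl | rfl
  · have := h.two p j
    have := h.two p k
    have := h.two p l
    have := h.two p q
    have := h.two j k
    have := h.two j l
    have := h.two j q
    have := h.two k l
    have := h.two k q
    have := h.two l q
    have := h'.two p j
    have := h'.two p k
    have := h'.two p l
    have := h'.two p q
    have := h'.two j k
    have := h'.two j l
    have := h'.two j q
    have := h'.two k l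
    have := h'.two k q
    have := h'.two l q
    clear h h'
    grind (splits := 40)
  · have := h.two i p
    have := h.two i k
    have := h.two i l
    have := h.two i q
    have := h.two p k
    have := h.two p l
    have := h.two p q
    have := h.two k l
    have := h.two k q
    have := h.two l q
    have := h'.two i p
    have := h'.two i k
    have := h'.two i l
    have := h'.two i q
    have := h'.two p k
    have := h'.two p l
    have := h'.two p q
    have := h'.two k l
    have := h'.two k q
    have := h'.two l q
    clear h h'
    grind (splits := 40)
  · have := h.two i j
    have := h.two i p
    have := h.two i l
    have := h.two i q
    have := h.two j p
    have := h.two j l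
    have := h.two j q
    have := h.two p l
    have := h.two p q
    have := h.two l q
    have := h'.two i j
    have := h'.two i p
    have := h'.two i l
    have := h'.two i q
    have := h'.two j p
    have := h'.two j l
    have := h'.two j q
    have := h'.two p l
    have := h'.two p q
    have := h'.two l q
    clear h h'
    grind (splits := 40)
  · have := h.two i j
    have := h.two i k
    have := h.two i p
    have := h.two i q
    have := h.two j k
    have := h.two j p
    have := h.two j q
    have := h.two k p
    have := h.two k q
    have := h.two p q
    have := h'.two i j
    have := h'.two i k
    have := h'.two i p
    have := h'.two i q
    have := h'.two j k
    have := h'.two j p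
    have := h'.two j q
    have := h'.two k p
    have := h'.two k q
    have := h'.two p q
    clear h h'
    grind (splits := 40)

set_option maxHeartbeats 4000000 in
theorem mixed2 {n : ℕ} (v x v' x' : Fin n → Fin n) (h : Cond v x) (h' : Cond v' x')
    (i j : Fin n) (hij : i < j) (hv : v i < v j)
    (hcov : ∀ e, i < e → e < j → v i < v e → v e < v j → False)
    (hi : v' i = v j) (hj : v' j = v i) (hv' : ∀ e, e ≠ i → e ≠ j → v' e = v e)
    (hoff : ∀ e, e ≠ i → e ≠ j → e ≠ x i → e ≠ x j → x' e = x e)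
    (p q : Fin n) (hpq : q.val = p.val + 1) (hq' : x' q = q) (hq : q < x q)
    (hp : x p = p) (hp' : x' p = p)
    (hpA : p ≠ i ∧ p ≠ j ∧ p ≠ x i ∧ p ≠ x j)
    (hqA : q = i ∨ q = j ∨ q = x i ∨ q = x j) : False := by
  have hplt : p < q := by omega
  have hpq' : ∀ a, a < q → a ≠ p → a < p := fun a h => by omega
  have hpq'' : ∀ a, p < a → a ≠ q → q < a := fun a h => by omega
  have st := stable_off x x' h.inv h'.inv i j hoff
  have s1 := st i (by simp)
  have s2 := st j (by simp)
  have s3 := st (x i) (by simp)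
  have s4 := st (x j) (by simp)
  have i1 := h.inv i
  have i2 := h.inv j
  have i1' := h'.inv i
  have i2' := h'.inv j
  have i3' := h'.inv (x i)
  have i4' := h'.inv (x j)
  have hvp := hv' p hpA.1 hpA.2.1
  have hvq := h.c1 q hq
  have hvq2 := h.c2 p q hp.ge hq.le hplt (by grind)
  have hpq2 := h'.c2 p q hp'.ge hq'.ge hplt (by rw [hp', hq']; exact hplt)
  rw [hq'] at hpq2
  clear hoff st
  generalize hk : x i = k at *
  generalize hl : x j = l at *
  rcases hqA with rfl | rfl | rfl | rfl
  · have := h.two q j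
    have := h.two q k
    have := h.two q l
    have := h.two q p
    have := h.two j k
    have := h.two j l
    have := h.two j p
    have := h.two k l
    have := h.two k p
    have := h.two l p
    have := h'.two q j
    have := h'.two q k
    have := h'.two q l
    have := h'.two q p
    have := h'.two j k
    have := h'.two j l
    have := h'.two j p
    have := h'.two k l
    have := h'.two k p
    have := h'.two l p
    clear h h'
    grind (splits := 40)
  · have := h.two i q
    have := h.two i k
    have := h.two i l
    have := h.two i p
    have := h.two q k
    have := h.two q l
    have := h.two q p
    have := h.two k l
    have := h.two k p
    have := h.two l p
    have := h'.two i q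
    have := h'.two i k
    have := h'.two i l
    have := h'.two i p
    have := h'.two q k
    have := h'.two q l
    have := h'.two q p
    have := h'.two k l
    have := h'.two k p
    have := h'.two l p
    clear h h'
    grind (splits := 40)
  · have := h.two i j
    have := h.two i q
    have := h.two i l
    have := h.two i p
    have := h.two j q
    have := h.two j l
    have := h.two j p
    have := h.two q l
    have := h.two q p
    have := h.two l p
    have := h'.two i j
    have := h'.two i q
    have := h'.two i l
    have := h'.two i p
    have := h'.two j q
    have := h'.two j l
    have := h'.two j p
    have := h'.two q l
    have := h'.two q p
    have := h'.two l p
    clear h h'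
    grind (splits := 40)
  · have := h.two i j
    have := h.two i k
    have := h.two i q
    have := h.two i p
    have := h.two j k
    have := h.two j q
    have := h.two j p
    have := h.two k q
    have := h.two k p
    have := h.two q p
    have := h'.two i j
    have := h'.two i k
    have := h'.two i q
    have := h'.two i p
    have := h'.two j k
    have := h'.two j q
    have := h'.two j p
    have := h'.two k q
    have := h'.two k p
    have := h'.two q p
    clear h h'
    grind (splits := 40)


/-- All possible patterns of the targets on the orbit of `i, j`. -/
def Tab {n : ℕ} (i j k l : Fin n) (f : Fin n → Fin n) : Prop :=
  (k = i → l = j → f i = j ∧ f j = i ∧ f k = j ∧ f l = i) ∧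
  (k = i → j < l → f i = l ∧ f j = j ∧ f k = l ∧ f l = i) ∧
  (k = i → i < l → l < j → f i = j ∧ f j = i ∧ f k = j ∧ f l = l) ∧
  (l = j → i < k → k < j → f i = j ∧ f j = i ∧ f k = k ∧ f l = i) ∧
  (l = j → k < i → f i = i ∧ f j = k ∧ f k = j ∧ f l = k) ∧
  (i < k → k < j → j < l → f i = l ∧ f j = j ∧ f k = k ∧ f l = i) ∧
  (i < k → k < l → l < j → f i = j ∧ f j = i ∧ f k = k ∧ f l = l) ∧
  (i < l → l < k → k < j → f i = j ∧ f j = i ∧ f k = l ∧ f l = k) ∧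
  (k < i → i < l → l < j → f i = i ∧ f j = k ∧ f k = j ∧ f l = l) ∧
  (k < i → j < l → f i = l ∧ f j = k ∧ f k = j ∧ f l = i) ∧
  (j < k → k < l → f i = l ∧ f j = k ∧ f k = j ∧ f l = i) ∧
  (k < l → l < i → f i = l ∧ f j = k ∧ f k = j ∧ f l = i) ∧
  (k = i → l < i → False) ∧
  (l = j → j < k → False) ∧
  (k = j → False) ∧
  (j < l → l < k → False) ∧
  (l < k → k < i → False) ∧
  (i < l → l < j → j < k → False) ∧
  (l < i → i < k → k < j → False) ∧
  (l < i → j < k → False)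

set_option maxHeartbeats 40000000 in
theorem tab_all {n : ℕ} (v x v' x' : Fin n → Fin n) (h : Cond v x) (h' : Cond v' x')
    (i j : Fin n) (hij : i < j) (hv : v i < v j)
    (hcov : ∀ e, i < e → e < j → v i < v e → v e < v j → False)
    (hi : v' i = v j) (hj : v' j = v i) (hv' : ∀ e, e ≠ i → e ≠ j → v' e = v e)
    (hoff : ∀ e, e ≠ i → e ≠ j → e ≠ x i → e ≠ x j → x' e = x e)
    (k l : Fin n) (hk : x i = k) (hl : x j = l) : Tab i j k l x' := by
  have st := stable_off x x' h.inv h'.inv i j hoff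
  have s1 := st i (by simp)
  have s2 := st j (by simp)
  have s3 := st (x i) (by simp)
  have s4 := st (x j) (by simp)
  have i1 := h.inv i
  have i2 := h.inv j
  have i1' := h'.inv i
  have i2' := h'.inv j
  have i3' := h'.inv (x i)
  have i4' := h'.inv (x j)
  clear hoff st
  rw [hk] at s1 s2 s3 s4 i1 i3'
  rw [hl] at s1 s2 s3 s4 i2 i4'
  have := h.two i j
  have := h.two i k
  have := h.two i l
  have := h.two j k
  have := h.two j l
  have := h.two k l
  have := h'.two i j
  have := h'.two i k
  have := h'.two i l
  have := h'.two j k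
  have := h'.two j l
  have := h'.two k l
  clear h h'
  unfold Tab
  refine ⟨?_, ?_, ?_, ?_, ?_, ?_, ?_, ?_, ?_, ?_, ?_, ?_, ?_, ?_, ?_, ?_, ?_, ?_, ?_, ?_⟩ <;> intros <;> grind (splits := 40)

theorem tab_inj {n : ℕ} (i j k l : Fin n) (hij : i < j) (hk : k = i ∨ (k ≠ i ∧ k ≠ l))
    (hl : l = j ∨ (l ≠ j ∧ l ≠ i))
    (f g : Fin n → Fin n) (hf : Tab i j k l f) (hg : Tab i j k l g) :
    f i = g i ∧ f j = g j ∧ f k = g k ∧ f l = g l := by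
  unfold Tab at hf hg
  have hkl : k = i ∨ k < i ∨ (i < k ∧ k < j) ∨ k = j ∨ j < k := by omega
  have hll : l = i ∨ l < i ∨ (i < l ∧ l < j) ∨ l = j ∨ j < l := by omega
  have h2 : k < l ∨ k = l ∨ l < k := by omega
  rcases hkl with hkl | hkl | hkl | hkl | hkl <;> rcases hll with hll | hll | hll | hll | hll <;>
    rcases h2 with h2 | h2 | h2 <;> grind

theorem cover_of_len {n : ℕ} (w : Perm (Fin n)) (i j : Fin n) (hij : i < j)
    (h : len n (w * swap i j) = len n w + 1) :
    w i < w j ∧ ∀ e, i < e → e < j → w i < w e → w e < w j → False := by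
  rw [len_eq, len_eq] at h
  have hlt : w i < w j := by
    by_contra hc
    have hne : w i ≠ w j := fun h => hij.ne (w.injective h)
    have := invNum_lt (w * swap i j) i j hij (by simp; omega)
    rw [mul_assoc, swap_mul_self, mul_one] at this
    omega
  refine ⟨hlt, fun e h1 h2 h3 h4 => ?_⟩
  have n1 : i ≠ e := h1.ne
  have n2 : e ≠ j := h2.ne
  have n3 : i ≠ j := hij.ne
  have a1 := invNum_lt w i e h1 h3
  have a2 := invNum_lt (w * swap i e) e j h2 (by
    simp [swap_apply_of_ne_of_ne n3.symm n2.symm]; omega)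
  have a3 := invNum_lt (w * swap i e * swap e j) i e h1 (by
    simp [swap_apply_of_ne_of_ne n1 n3, swap_apply_of_ne_of_ne n3.symm n2.symm]; omega)
  have : w * swap i e * swap e j * swap i e = w * swap i j := by
    rw [mul_assoc, mul_assoc]
    congr 1
    ext a
    simp only [Perm.mul_apply]
    by_cases b1 : a = i
    · subst b1; simp [swap_apply_of_ne_of_ne n3.symm n2.symm]
    by_cases b2 : a = j
    · subst b2; simp [swap_apply_of_ne_of_ne n3.symm n2.symm]
    by_cases b3 : a = e
    · subst b3; simp [swap_apply_of_ne_of_ne n1 n3, swap_apply_of_ne_of_ne n1.symm n2]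
    simp [swap_apply_of_ne_of_ne, *]
  rw [this] at a3
  omega

theorem inv_apply_self {n : ℕ} {y : Perm (Fin n)} (h : y⁻¹ = y) (a : Fin n) : y (y a) = a := by
  have h2 : y * y = 1 := by
    nth_rewrite 1 [← h]
    exact inv_mul_cancel y
  have := congrArg (fun f : Perm (Fin n) => f a) h2
  simpa using this

theorem off {n : ℕ} (N : ℕ) : ∀ (w y z : Perm (Fin n)) (i j : Fin n), invNum n w = N →
    IsAtomOf n w y → IsAtomOf n (w * swap i j) z → i < j → w i < w j →
    (∀ e, i < e → e < j → w i < w e → w e < w j → False) →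
    ∀ a, a ≠ i → a ≠ j → a ≠ y i → a ≠ y j → z a = y a := by
  induction N using Nat.strong_induction_on with
  | _ N ih =>
  intro w y z i j hN hw hw' hij hv hcov a hai haj hayi hayj
  obtain ⟨p, q, hpq, hd⟩ := exists_descent (w * swap i j) i j hij (by simpa using hv)
  have hi : (w * swap i j) i = w j := by simp
  have hj : (w * swap i j) j = w i := by simp
  have he : ∀ e, e ≠ i → e ≠ j → (w * swap i j) e = w e := fun e h1 h2 => by
    simp [swap_apply_of_ne_of_ne h1 h2]
  have hpltq : p < q := by omega
  have yinv : ∀ b, y (y b) = b := fun b => inv_apply_self (by rw [← hw.1]; exact dem_symm w) b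
  by_cases hwd : w q < w p
  · obtain ⟨x, hx, hxi, hxlt, hxc⟩ := atom_down w y hw p q hpq hwd
    obtain ⟨x', hx', hxi', hxlt', hxc'⟩ := atom_down (w * swap i j) z hw' p q hpq hd
    have hNs := invNum_simple_down w p q hpq hwd
    have xinv := inv_apply_self hxi
    have xinv' := inv_apply_self hxi'
    set s := swap p q with hs
    have sp : s p = q := by simp [hs]
    have sq : s q = p := by simp [hs]
    have so : ∀ e, e ≠ p → e ≠ q → s e = e := fun e h1 h2 => swap_apply_of_ne_of_ne h1 h2
    have ss : ∀ e, s (s e) = e := fun e => by simp [hs]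
    have hcomm : w * swap i j * s = w * s * swap (s i) (s j) := by
      rw [mul_assoc, mul_assoc]
      congr 1
      rw [Equiv.mul_swap_eq_swap_mul s, ss, ss]
    have hmono : ∀ c d, c < d → ¬ (c = p ∧ d = q) → s c < s d := by
      intro c d hcd hn
      have h1 := swap_cases p q c
      have h2 := swap_cases p q d
      rw [← hs] at h1 h2
      omega
    have hij1 : s i < s j := hmono i j hij (by rintro ⟨rfl, rfl⟩; omega)
    have hcov1 : ∀ e, s i < e → e < s j → w (s (s i)) < w (s e) → w (s e) < w (s (s j)) →
        False := by
      intro e h1 h2 h3 h4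
      rw [ss] at h3 h4
      by_cases c1 : s i = p ∧ e = q
      · obtain ⟨c1, rfl⟩ := c1
        have : i = e := by rw [← ss i, c1, sp]
        grind
      by_cases c2 : e = p ∧ s j = q
      · obtain ⟨rfl, c2⟩ := c2
        have : j = e := by rw [← ss j, c2, sq]
        grind
      have h1' := hmono _ _ h1 c1
      have h2' := hmono _ _ h2 c2
      rw [ss] at h1' h2'
      exact hcov _ h1' h2' h3 h4
    rw [hcomm] at hx'
    have hoff := ih _ (by omega) (w * s) x x' (s i) (s j) rfl hx hx' hij1
      (by simpa [ss] using hv) (by simpa using hcov1)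
    have hC := cond_of_atom _ _ hx
    have hC' := cond_of_atom _ _ hx'
    have hvi : (w * s * swap (s i) (s j)) (s i) = (w * s) (s j) := by simp
    have hvj : (w * s * swap (s i) (s j)) (s j) = (w * s) (s i) := by simp
    have hve : ∀ e, e ≠ s i → e ≠ s j → (w * s * swap (s i) (s j)) e = (w * s) e :=
      fun e h1 h2 => by simp [swap_apply_of_ne_of_ne h1 h2]
    have m1 := mixed1 (w * s) x _ x' hC hC' (s i) (s j) hij1 (by simpa [ss] using hv)
      (by simpa using hcov1) hvi hvj hve hoff p q hpq
    have m2 := mixed2 (w * s) x _ x' hC hC' (s i) (s j) hij1 (by simpa [ss] using hv)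
      (by simpa using hcov1) hvi hvj hve hoff p q hpq
    clear hC hC' hvi hvj hve ih
    have sinj : ∀ c d, s c = s d → c = d := fun c d h => s.injective h
    have b1 : s a ≠ s i := fun h => hai (sinj _ _ h)
    have b2 : s a ≠ s j := fun h => haj (sinj _ _ h)
    rcases hxc with ⟨xp, xq, rfl⟩ | ⟨xn, rfl⟩
    · simp only [Perm.mul_apply] at *
      have key : ∀ c, a ≠ c → a ≠ x (s c) → s a ≠ x (s c) := by
        intro c h1 h2 h3
        by_cases ap : a = p
        · subst ap
          apply h1
          have : s c = q := by rw [← xinv (s c), ← h3, sp, xq]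
          rw [← ss c, this, sq]
        by_cases aq : a = q
        · subst aq
          apply h1
          have : s c = p := by rw [← xinv (s c), ← h3, sq, xp]
          rw [← ss c, this, sp]
        rw [so a ap aq] at h3
        exact h2 h3
      have b3 : s a ≠ x (s i) := key i hai hayi
      have b4 : s a ≠ x (s j) := key j haj hayj
      have hb := hoff _ b1 b2 b3 b4
      rcases hxc' with ⟨xp', xq', rfl⟩ | ⟨xn', rfl⟩
      · exact hb
      · simp only [Perm.mul_apply]
        rw [hb]
        clear m1 m2 hcomm
        have s_i := swap_cases p q i
        have s_j := swap_cases p q j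
        rw [← hs] at s_i s_j
        have i1 := xinv (s i)
        have i2 := xinv (s j)
        have o1 := hoff p
        have o2 := hoff q
        by_cases ap : a = p
        · subst ap
          exfalso
          grind
        by_cases aq : a = q
        · subst aq
          exfalso
          grind
        rw [so a ap aq]
        apply so
        · intro h
          apply ap
          rw [← xinv a, h, xp]
        · intro h
          apply aq
          rw [← xinv a, h, xq]
    · simp only [Perm.mul_apply] at *
      have b3 : s a ≠ x (s i) := fun h => hayi (by rw [← h, ss])
      have b4 : s a ≠ x (s j) := fun h => hayj (by rw [← h, ss])
      have hb := hoff _ b1 b2 b3 b4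
      rcases hxc' with ⟨xp', xq', rfl⟩ | ⟨xn', rfl⟩
      · simp only [Perm.mul_apply]
        have hxne : x p ≠ x q := hxlt.ne
        have ap : s a ≠ p := by
          intro h
          rw [h] at b1 b2 b3 b4 hb
          have xp : x p = p := by rw [← hb, xp']
          have xq : x q ≠ q := fun h => xn ⟨xp, h⟩
          refine m2 xq' (by omega) xp xp' ⟨b1, b2, b3, b4⟩ ?_
          by_contra hc
          push Not at hc
          exact xq (by rw [← hoff q hc.1 hc.2.1 hc.2.2.1 hc.2.2.2, xq'])
        have aq : s a ≠ q := by
          intro h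
          rw [h] at b1 b2 b3 b4 hb
          have xq : x q = q := by rw [← hb, xq']
          have xp : x p ≠ p := fun h => xn ⟨h, xq⟩
          refine m1 xp' (by omega) xq xq' ⟨b1, b2, b3, b4⟩ ?_
          by_contra hc
          push Not at hc
          exact xp (by rw [← hoff p hc.1 hc.2.1 hc.2.2.1 hc.2.2.2, xp'])
        rw [← hb]
        refine (so _ (fun h => ap ?_) (fun h => aq ?_)).symm
        · rw [← xinv' (s a), h, xp']
        · rw [← xinv' (s a), h, xq']
      · simp only [Perm.mul_apply]
        rw [hb]
  · have hne : w p ≠ w q := fun h => hpltq.ne (w.injective h)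
    have hlt : w p < w q := by omega
    have hpi : p = i ∧ q = j := by
      have e1 := he p
      have e2 := he q
      have c1 := hcov p
      have c2 := hcov q
      clear hcov he ih
      generalize w * swap i j = w' at *
      by_cases pi : p = i
      · subst pi
        by_cases qj : q = j
        · exact ⟨rfl, qj⟩
        · exfalso
          have := e2 hpltq.ne' qj
          exact c2 (by omega) (by omega) (by omega) (by omega)
      · exfalso
        by_cases pj : p = j
        · subst pj
          have := e2 (by omega) (by omega)
          omega
        · have := e1 pi pj
          by_cases qi : q = i
          · subst qi
            omega
          by_cases qj : q = j
          · subst qj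
            exact c1 (by omega) (by omega) (by omega) (by omega)
          · have := e2 qi qj
            omega
    obtain ⟨rfl, rfl⟩ := hpi
    obtain ⟨x, hx, -, -, hxc⟩ := atom_down (w * swap p q) z hw' p q hpq hd
    rw [mul_assoc, swap_mul_self, mul_one] at hx
    have hxy : x = y := by rw [← hx.1, hw.1]
    subst hxy
    have h1 : swap p q a = a := swap_apply_of_ne_of_ne hai haj
    rcases hxc with ⟨-, -, rfl⟩ | ⟨-, rfl⟩
    · simp [h1]
    · simp only [Perm.mul_apply, h1]
      exact swap_apply_of_ne_of_ne (fun h => hayi (by rw [← h, yinv]))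
        (fun h => hayj (by rw [← h, yinv]))

theorem tab_of_atoms {n : ℕ} (w y z : Perm (Fin n)) (i j : Fin n) (hij : i < j)
    (hw : IsAtomOf n w y) (hlen : len n (w * swap i j) = len n w + 1)
    (hz : IsAtomOf n (w * swap i j) z) :
    Tab i j (y i) (y j) z ∧ ∀ a, a ≠ i → a ≠ j → a ≠ y i → a ≠ y j → z a = y a := by
  obtain ⟨hv, hcov⟩ := cover_of_len w i j hij hlen
  have hoff := off _ w y z i j rfl hw hz hij hv hcov
  exact ⟨tab_all w y _ z (cond_of_atom _ _ hw) (cond_of_atom _ _ hz) i j hij hv hcov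
    (by simp) (by simp) (fun e h1 h2 => by simp [swap_apply_of_ne_of_ne h1 h2]) hoff
    _ _ rfl rfl, hoff⟩

/-- Uniqueness of the target of the transition operator `τ_{ij}`: if
`A_{ij}(y) ∩ A(z) ≠ ∅` and `A_{ij}(y) ∩ A(z') ≠ ∅` for involutions `z, z'`,
then `z = z'`. Here `A_{ij}(y) = {w t_{ij} : w ∈ A(y), ℓ(w t_{ij}) = ℓ(w) + 1}`. -/
theorem tau_target_unique (n : ℕ) (y z z' : Equiv.Perm (Fin n))
    (hy : y⁻¹ = y) (hz : z⁻¹ = z) (hz' : z'⁻¹ = z')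
    (i j : Fin n) (hij : i < j)
    (h1 : ∃ w : Equiv.Perm (Fin n), IsAtomOf n w y ∧
      len n (w * Equiv.swap i j) = len n w + 1 ∧ IsAtomOf n (w * Equiv.swap i j) z)
    (h2 : ∃ w : Equiv.Perm (Fin n), IsAtomOf n w y ∧
      len n (w * Equiv.swap i j) = len n w + 1 ∧ IsAtomOf n (w * Equiv.swap i j) z') :
    z = z' := by
  obtain ⟨w, hw, hl, ha⟩ := h1
  obtain ⟨w', hw', hl', ha'⟩ := h2
  obtain ⟨t1, o1⟩ := tab_of_atoms w y z i j hij hw hl ha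
  obtain ⟨t2, o2⟩ := tab_of_atoms w' y z' i j hij hw' hl' ha'
  have yinv := inv_apply_self hy
  have e1 := yinv i
  have e2 := yinv j
  have hne : y i ≠ y j := fun h => hij.ne (y.injective h)
  obtain ⟨r1, r2, r3, r4⟩ := tab_inj i j (y i) (y j) hij
    (by by_cases h : y i = i
        · exact Or.inl h
        · exact Or.inr ⟨h, hne⟩)
    (by by_cases h : y j = j
        · exact Or.inl h
        · by_cases h' : y j = i
          · exfalso
            have h3 : y i = j := by rw [← h', e2]
            unfold Tab at t1
            rw [h3, h'] at t1
            simp at t1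
          · exact Or.inr ⟨h, h'⟩) z z' t1 t2
  refine Equiv.ext fun a => ?_
  by_cases c1 : a = i
  · rw [c1, r1]
  by_cases c2 : a = j
  · rw [c2, r2]
  by_cases c3 : a = y i
  · rw [c3, r3]
  by_cases c4 : a = y j
  · rw [c4, r4]
  rw [o1 a c1 c2 c3 c4, o2 a c1 c2 c3 c4]
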